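/- Let n be a positive integer and let x be a complex number which is not an integer. Then Σ_{k=0}^{n} (−1)^k C(n,k) · C(n+k,k)/C(x+k,k) · k · H_k(x)² = (−1)^n · (n(n+1)/(2(1−x))) · (C(−x+n,n)/C(x+n,n)) · { H_n^{⟨2⟩}(x) − H_n^{⟨2⟩}(−x) + 2[H_n(x) + H_n(−x)] · [H_n(x) + H_n(−x) − 2/(1−x)] − [H_n(x) − H_n(−x)] · [H_n(x) − H_n(−x) − 2H_{n+1}((x−n−2)/2) − 2(x² − n − n²)/(x n (n+1))] − H_n((x−n)/2) · [H_{n+1}((x−n−2)/2) + 2(x³ − n x² + n² + n³)/(x(x−n) n (n+1))] + 4/(1−x)² − 4(x² − n x + n + n²)/(x(x−n)²(n+1)) }. -/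

import Mathlib

open Finset

/-- Generalized harmonic number `H_n(x) = ∑_{k=1}^n 1/(x+k)`. -/
noncomputable def genH (n : ℕ) (x : ℂ) : ℂ := ∑ k ∈ Finset.range n, 1 / (x + (k + 1))

/-- Generalized second-order harmonic number `H_n^{⟨2⟩}(x) = ∑_{k=1}^n 1/(x+k)^2`. -/
noncomputable def genH2 (n : ℕ) (x : ℂ) : ℂ := ∑ k ∈ Finset.range n, 1 / (x + (k + 1)) ^ 2

/-- Generalized binomial coefficient `C(z,m) = (∏_{j=0}^{m-1} (z-j))/m!`. -/
noncomputable def cbinom (z : ℂ) (m : ℕ) : ℂ := (∏ j ∈ Finset.range m, (z - j)) / (m.factorial : ℂ)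

theorem genH_succ (n : ℕ) (x : ℂ) : genH (n + 1) x = genH n x + 1 / (x + (n + 1)) := by
  simp [genH, Finset.sum_range_succ]

theorem genH2_succ (n : ℕ) (x : ℂ) : genH2 (n + 1) x = genH2 n x + 1 / (x + (n + 1)) ^ 2 := by
  simp [genH2, Finset.sum_range_succ]

theorem genH_succ_left (n : ℕ) (x : ℂ) : genH (n + 1) x = 1 / (x + 1) + genH n (x + 1) := by
  simp only [genH, Finset.sum_range_succ', Nat.cast_add, Nat.cast_one, Nat.cast_zero, zero_add]
  rw [add_comm]
  congr 1
  exact Finset.sum_congr rfl fun k _ => by ring_nf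

theorem cbinom_add_self (x : ℂ) (k : ℕ) :
    cbinom (x + k) k = (∏ j ∈ range k, (x + (j + 1))) / (k.factorial : ℂ) := by
  unfold cbinom
  rw [← Finset.prod_range_reflect]
  congr 1
  refine Finset.prod_congr rfl fun j hj => ?_
  have hj := Finset.mem_range.mp hj
  rw [Nat.sub_sub, Nat.cast_sub (by omega)]
  push_cast
  ring

theorem cbinom_succ (x : ℂ) (k : ℕ) :
    cbinom (x + (k + 1 : ℕ)) (k + 1) = cbinom (x + k) k * (x + (k + 1)) / (k + 1) := by
  have : (k.factorial : ℂ) ≠ 0 := by exact_mod_cast k.factorial_ne_zero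
  have : (k + 1 : ℂ) ≠ 0 := by exact_mod_cast k.succ_ne_zero
  rw [cbinom_add_self, cbinom_add_self, Finset.prod_range_succ, Nat.factorial_succ]
  push_cast
  field_simp

/-- The hypergeometric weight `(-1)^k C(n,k) C(n+k,k) / C(x+k,k)`. -/
noncomputable def weight (x : ℂ) (n k : ℕ) : ℂ :=
  (-1 : ℂ) ^ k * (n.choose k : ℂ) * (((n + k).choose k : ℂ) / cbinom (x + k) k)

theorem weight_eq_zero {x : ℂ} {n k : ℕ} (h : n < k) : weight x n k = 0 := by
  simp [weight, Nat.choose_eq_zero_of_lt h]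

theorem sub_mul_choose_succ (n k : ℕ) :
    ((n : ℂ) + 1 - k) * ((n + 1).choose k : ℂ) = (n + 1) * (n.choose k : ℂ) := by
  rcases le_or_gt k (n + 1) with h | h
  · have := congrArg (Nat.cast (R := ℂ)) (Nat.choose_mul_succ_eq n k)
    rw [Nat.cast_mul, Nat.cast_mul, Nat.cast_sub h] at this
    push_cast at this
    linear_combination -this
  · simp [Nat.choose_eq_zero_of_lt h, Nat.choose_eq_zero_of_lt (show n < k by omega)]

theorem succ_mul_choose_succ_right (n k : ℕ) :
    ((k : ℂ) + 1) * (n.choose (k + 1) : ℂ) = (n - k) * (n.choose k : ℂ) := by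
  rcases le_or_gt k n with h | h
  · have := congrArg (Nat.cast (R := ℂ)) (Nat.choose_succ_right_eq n k)
    rw [Nat.cast_mul, Nat.cast_mul, Nat.cast_sub h] at this
    push_cast at this
    linear_combination this
  · simp [Nat.choose_eq_zero_of_lt h, Nat.choose_eq_zero_of_lt (show n < k + 1 by omega)]

/-- Contiguity of the weight in its degree. -/
theorem weight_succ_degree (x : ℂ) (n k : ℕ) :
    ((n : ℂ) + 1 - k) * weight x (n + 1) k = (n + 1 + k) * weight x n k := by
  have h1 := sub_mul_choose_succ n k
  have h2 := sub_mul_choose_succ (n + k) k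
  rw [show n + k + 1 = n + 1 + k by ring] at h2
  push_cast at h2
  have hn : (n + 1 : ℂ) ≠ 0 := by exact_mod_cast n.succ_ne_zero
  have h3 : ((n + 1 + k).choose k : ℂ) = (n + 1 + k) * ((n + k).choose k : ℂ) / (n + 1) := by
    rw [eq_div_iff hn]
    linear_combination h2
  unfold weight
  rw [h3]
  field_simp
  linear_combination (((n + 1 + k) * ((n + k).choose k : ℂ)) / cbinom (x + k) k) * h1

/-- Contiguity of the weight in its summation index. -/
theorem weight_succ_index (x : ℂ) (hx : ∀ m : ℕ, x + (m + 1) ≠ 0) (n k : ℕ) :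
    ((k : ℂ) + 1) * (x + (k + 1)) * weight x n (k + 1) =
      -((n - k) * (n + 1 + k) * weight x n k) := by
  have h1 := succ_mul_choose_succ_right n k
  have h2 := congrArg (Nat.cast (R := ℂ)) (Nat.add_one_mul_choose_eq (n + k) k)
  push_cast at h2
  have hk : (k + 1 : ℂ) ≠ 0 := by exact_mod_cast k.succ_ne_zero
  have hxk := hx k
  have h3 : ((n + (k + 1)).choose (k + 1) : ℂ) = (n + k + 1) * ((n + k).choose k : ℂ) / (k + 1) := by
    rw [eq_div_iff hk]
    exact h2.symm
  unfold weight
  rw [h3, cbinom_succ, pow_succ]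
  field_simp
  linear_combination (-(n + k + 1) * ((n + k).choose k : ℂ) / cbinom (x + k) k) * h1

/-- Chu–Vandermonde summation, together with its derivative in the lower parameter, for the
sequence `(-1)^j C(m,j) (c-d)_j/(c)_j`. -/
theorem sum_vandermonde (d : ℂ) (hd : ∀ j : ℕ, d + j ≠ 0) (m : ℕ) (c : ℂ)
    (hc : ∀ j : ℕ, c + j ≠ 0) :
    (∑ j ∈ range (m + 1), (-1 : ℂ) ^ j * (m.choose j : ℂ) *
        ∏ i ∈ range j, ((c - d + i) / (c + i))) = ∏ i ∈ range m, ((d + i) / (c + i)) ∧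
    (∑ j ∈ range (m + 1), (-1 : ℂ) ^ j * (m.choose j : ℂ) *
        (∏ i ∈ range j, ((c - d + i) / (c + i))) * genH j (c - 1)) =
      (∏ i ∈ range m, ((d + i) / (c + i))) * (genH m (c - 1) - genH m (d - 1)) := by
  induction m generalizing c with
  | zero => simp [genH]
  | succ m ih =>
    have hc' : ∀ j : ℕ, c + 1 + j ≠ 0 := fun j => by
      have := hc (j + 1)
      push_cast at this
      convert this using 1
      ring
    obtain ⟨f0, g0⟩ := ih c hc
    obtain ⟨f1, g1⟩ := ih (c + 1) hc'
    have c0 : c ≠ 0 := by simpa using hc 0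
    have cm := hc m
    have dm := hd m
    have pascal : ∀ φ : ℕ → ℂ,
        ∑ j ∈ range (m + 1 + 1), (-1 : ℂ) ^ j * ((m + 1).choose j : ℂ) * φ j =
          ∑ j ∈ range (m + 1), (-1 : ℂ) ^ j * (m.choose j : ℂ) * φ j -
          ∑ j ∈ range (m + 1), (-1 : ℂ) ^ j * (m.choose j : ℂ) * φ (j + 1) := by
      intro φ
      have e : ∑ j ∈ range (m + 1), (-1 : ℂ) ^ j * (m.choose j : ℂ) * φ j =
          ∑ j ∈ range (m + 1), (-1 : ℂ) ^ (j + 1) * (m.choose (j + 1) : ℂ) * φ (j + 1) + φ 0 := by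
        have := Finset.sum_range_succ' (fun j => (-1 : ℂ) ^ j * (m.choose j : ℂ) * φ j) (m + 1)
        rw [Finset.sum_range_succ] at this
        simpa using this
      rw [Finset.sum_range_succ', e, add_sub_right_comm, ← Finset.sum_sub_distrib]
      simp only [Nat.choose_succ_succ, pow_zero, Nat.choose_zero_right, Nat.cast_one, one_mul]
      congr 1
      refine Finset.sum_congr rfl fun j _ => ?_
      push_cast
      ring
    have hprod : ∀ a : ℂ, ∀ j : ℕ, ∏ i ∈ range (j + 1), ((a + i) / (c + i)) =
        a / c * ∏ i ∈ range j, ((a + 1 + i) / (c + 1 + i)) := by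
      intro a j
      rw [Finset.prod_range_succ', mul_comm]
      congr 1
      · simp
      · refine Finset.prod_congr rfl fun i _ => ?_
        push_cast
        ring_nf
    have hshift : ∏ i ∈ range m, ((d + i) / (c + 1 + i)) =
        (∏ i ∈ range m, ((d + i) / (c + i))) * (c / (c + m)) := by
      clear ih f0 g0 f1 g1 pascal cm dm
      induction m with
      | zero => simp [c0]
      | succ m ih =>
        rw [Finset.prod_range_succ, ih, Finset.prod_range_succ]
        have := hc m
        have := hc' m
        have e : c + ((m + 1 : ℕ) : ℂ) = c + 1 + m := by push_cast; ring
        rw [e]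
        field_simp
    have hH : genH m c = genH m (c - 1) - 1 / c + 1 / (c + m) := by
      have h1 := genH_succ m (c - 1)
      have h2 := genH_succ_left m (c - 1)
      rw [sub_add_cancel] at h2
      rw [show c - 1 + ((m : ℂ) + 1) = c + m by ring] at h1
      linear_combination h1 - h2
    have hcd : c + 1 - d = c - d + 1 := by ring
    rw [hcd] at f1 g1
    rw [add_sub_cancel_right] at g1
    constructor
    · rw [pascal, f0]
      simp only [hprod (c - d)]
      have : ∑ j ∈ range (m + 1), (-1 : ℂ) ^ j * (m.choose j : ℂ) *
          ((c - d) / c * ∏ i ∈ range j, ((c - d + 1 + i) / (c + 1 + i))) =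
          (c - d) / c * ∏ i ∈ range m, ((d + i) / (c + 1 + i)) := by
        rw [← f1, Finset.mul_sum]
        exact Finset.sum_congr rfl fun j _ => by ring
      rw [this, hshift, Finset.prod_range_succ]
      field_simp
      ring
    · have := pascal fun j => (∏ i ∈ range j, ((c - d + i) / (c + i))) * genH j (c - 1)
      simp only [← mul_assoc] at this
      rw [this, g0]
      simp only [hprod (c - d), genH_succ_left _ (c - 1), sub_add_cancel]
      have : ∑ j ∈ range (m + 1), (-1 : ℂ) ^ j * (m.choose j : ℂ) *
          ((c - d) / c * ∏ i ∈ range j, ((c - d + 1 + i) / (c + 1 + i))) *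
            (1 / c + genH j c) =
          (c - d) / c * ((∏ i ∈ range m, ((d + i) / (c + 1 + i))) * (genH m c - genH m (d - 1)) +
            1 / c * ∏ i ∈ range m, ((d + i) / (c + 1 + i))) := by
        rw [← g1, ← f1, Finset.mul_sum, ← Finset.sum_add_distrib, Finset.mul_sum]
        exact Finset.sum_congr rfl fun j _ => by ring
      rw [this, hshift, Finset.prod_range_succ, hH, genH_succ m (d - 1),
        show d - 1 + ((m : ℂ) + 1) = d + m by ring]
      field_simp
      ring

/-- Chu–Vandermonde summation for a sequence given by its term ratio. -/
theorem sum_of_term_ratio {c d : ℂ} (hc : ∀ j : ℕ, c + j ≠ 0) (hd : ∀ j : ℕ, d + j ≠ 0) (m : ℕ)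
    (r : ℕ → ℂ) (hr : ∀ j : ℕ, (j + 1) * (c + j) * r (j + 1) = -((m - j) * (c - d + j) * r j)) :
    ∑ j ∈ range (m + 1), r j = r 0 * ∏ i ∈ range m, ((d + i) / (c + i)) ∧
    ∑ j ∈ range (m + 1), r j * genH j (c - 1) =
      r 0 * (∏ i ∈ range m, ((d + i) / (c + i))) * (genH m (c - 1) - genH m (d - 1)) := by
  have key : ∀ j, r j = r 0 * ((-1 : ℂ) ^ j * (m.choose j : ℂ) *
      ∏ i ∈ range j, ((c - d + i) / (c + i))) := by
    intro j
    induction j with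
    | zero => simp
    | succ j ih =>
      have hj : (j + 1 : ℂ) ≠ 0 := by exact_mod_cast j.succ_ne_zero
      have hcj := hc j
      have h1 := succ_mul_choose_succ_right m j
      have h2 := hr j
      rw [ih] at h2
      apply mul_left_cancel₀ (mul_ne_zero hj hcj)
      rw [h2, Finset.prod_range_succ, pow_succ]
      generalize ∏ i ∈ range j, ((c - d + i) / (c + i)) = p
      field_simp
      linear_combination (r 0 * p * (c - d + j)) * h1
  obtain ⟨h1, h2⟩ := sum_vandermonde d hd m c hc
  constructor
  · rw [← h1, Finset.mul_sum]
    exact Finset.sum_congr rfl fun j _ => key j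
  · rw [mul_assoc, ← h2, Finset.mul_sum]
    exact Finset.sum_congr rfl fun j _ => by rw [key j]; ring

/-- The product `∏_{j=1}^n (x-j)/(x+j)`. -/
noncomputable def ratioProd (n : ℕ) (x : ℂ) : ℂ :=
  ∏ j ∈ range n, ((x - (j + 1)) / (x + (j + 1)))

theorem ratioProd_succ (n : ℕ) (x : ℂ) :
    ratioProd (n + 1) x = ratioProd n x * ((x - (n + 1)) / (x + (n + 1))) := by
  rw [ratioProd, Finset.prod_range_succ, ratioProd]

theorem ratioProd_eq_cbinom (n : ℕ) (x : ℂ) :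
    ratioProd n x = (-1 : ℂ) ^ n * (cbinom (-x + n) n / cbinom (x + n) n) := by
  have : (n.factorial : ℂ) ≠ 0 := by exact_mod_cast n.factorial_ne_zero
  have h : ∏ j ∈ range n, (-x + ((j : ℂ) + 1)) = (-1) ^ n * ∏ j ∈ range n, (x - (j + 1)) := by
    have := Finset.prod_const (s := range n) (-1 : ℂ)
    rw [Finset.card_range] at this
    rw [← this, ← Finset.prod_mul_distrib]
    exact Finset.prod_congr rfl fun j _ => by ring
  rw [cbinom_add_self, cbinom_add_self, div_div_div_cancel_right₀ this, h,
    ratioProd, Finset.prod_div_distrib, ← mul_div_assoc, ← mul_assoc, ← mul_pow]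
  simp

theorem prod_sub_natCast_add (y : ℂ) (m : ℕ) :
    ∏ i ∈ range m, (y - m + i) = ∏ i ∈ range m, (y - (i + 1)) := by
  rw [← Finset.prod_range_reflect]
  refine Finset.prod_congr rfl fun j hj => ?_
  have hj := Finset.mem_range.mp hj
  rw [Nat.sub_sub, Nat.cast_sub (by omega)]
  push_cast
  ring

theorem genH_sub_natCast (y : ℂ) (m : ℕ) : genH m (y - m - 1) = -genH m (-y) := by
  unfold genH
  rw [← Finset.sum_range_reflect, ← Finset.sum_neg_distrib]
  refine Finset.sum_congr rfl fun j hj => ?_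
  have hj := Finset.mem_range.mp hj
  rw [Nat.sub_sub, Nat.cast_sub (by omega), ← one_div_neg_eq_neg_one_div]
  push_cast
  ring_nf

section NonInteger

variable {x : ℂ}

theorem add_natCast_ne_zero_of_not_int (hx : ∀ m : ℤ, x ≠ (m : ℂ)) (m : ℕ) : x + m ≠ 0 :=
  fun h => hx (-m) (by push_cast; linear_combination h)

theorem sub_natCast_ne_zero_of_not_int (hx : ∀ m : ℤ, x ≠ (m : ℂ)) (m : ℕ) : x - m ≠ 0 :=
  fun h => hx m (by push_cast; linear_combination h)

theorem add_succ_ne_zero_of_not_int (hx : ∀ m : ℤ, x ≠ (m : ℂ)) (m : ℕ) : x + (m + 1) ≠ 0 := by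
  exact_mod_cast add_natCast_ne_zero_of_not_int hx (m + 1)

theorem prod_add_three (hx : ∀ m : ℤ, x ≠ (m : ℂ)) (m : ℕ) :
    ∏ i ∈ range m, (x + 3 + i) =
      (∏ i ∈ range m, (x + (i + 1))) * (x + m + 1) * (x + m + 2) / ((x + 1) * (x + 2)) := by
  have h1 : x + 1 ≠ 0 := by exact_mod_cast add_natCast_ne_zero_of_not_int hx 1
  have h2 : x + 2 ≠ 0 := by exact_mod_cast add_natCast_ne_zero_of_not_int hx 2
  induction m with
  | zero => simp [h1, h2]
  | succ m ih =>
    rw [Finset.prod_range_succ, Finset.prod_range_succ, ih]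
    push_cast
    field_simp
    ring

/-- The weight with the falling factor `k (k - 1)`, arising from summation by parts. -/
noncomputable def fallingWeight (x : ℂ) (n k : ℕ) : ℂ :=
  k * (k - 1) * weight x (n + 1) k / (n + 1 + k)

theorem fallingWeight_eq_zero {n k : ℕ} (h : n + 1 < k) : fallingWeight x n k = 0 := by
  simp [fallingWeight, weight_eq_zero h]

/-- Value at the index `2`. -/
theorem weight_two (hx : ∀ m : ℤ, x ≠ (m : ℂ)) (n : ℕ) :
    2 * (x + 1) * (x + 2) * weight x n 2 = n * (n + 1) * (n - 1) * (n + 2) := by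
  have h0 := weight_succ_index x (add_succ_ne_zero_of_not_int hx) n 0
  have h1 := weight_succ_index x (add_succ_ne_zero_of_not_int hx) n 1
  have hw : weight x n 0 = 1 := by simp [weight, cbinom]
  rw [hw] at h0
  norm_num at h0 h1
  linear_combination (x + 1) * h1 - (n - 1 : ℂ) * (n + 2) * h0

theorem sum_range_add_two_of_zero {f : ℕ → ℂ} (h0 : f 0 = 0) (h1 : f 1 = 0) (m : ℕ) :
    ∑ k ∈ range (m + 2), f k = ∑ j ∈ range m, f (j + 2) := by
  rw [Finset.sum_range_succ', Finset.sum_range_succ', h0, zero_add, h1, add_zero, add_zero]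

theorem sum_weight_div (hx : ∀ m : ℤ, x ≠ (m : ℂ)) (n : ℕ) :
    ∑ k ∈ range (n + 3), (k : ℂ) * (k - 1) * weight x (n + 2) k / ((n + 2 + k) * (n + 1 + k)) =
      (n + 1) * (n + 2) * ratioProd n x / ((x + n + 1) * (x + n + 2)) := by
  have x1 : x + 1 ≠ 0 := by exact_mod_cast add_natCast_ne_zero_of_not_int hx 1
  have x2 : x + 2 ≠ 0 := by exact_mod_cast add_natCast_ne_zero_of_not_int hx 2
  have hc : ∀ j : ℕ, x + 3 + j ≠ 0 := fun j h =>
    hx (-3 - j) (by push_cast; linear_combination h)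
  have hd : ∀ j : ℕ, x - n + j ≠ 0 := fun j h =>
    hx (n - j) (by push_cast; linear_combination h)
  rw [sum_range_add_two_of_zero (by simp) (by simp)]
  have main := (sum_of_term_ratio hc hd n
    (fun j => ((j + 2 : ℕ) : ℂ) * ((j + 2 : ℕ) - 1) * weight x (n + 2) (j + 2) /
      ((n + 2 + (j + 2 : ℕ)) * (n + 1 + (j + 2 : ℕ)))) (fun j => by
      have h := weight_succ_index x (add_succ_ne_zero_of_not_int hx) (n + 2) (j + 2)
      have a1 : (n + j + 3 : ℂ) ≠ 0 := by exact_mod_cast (n + j + 2).succ_ne_zero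
      have a2 : (n + j + 4 : ℂ) ≠ 0 := by exact_mod_cast (n + j + 3).succ_ne_zero
      have a3 : (n + j + 5 : ℂ) ≠ 0 := by exact_mod_cast (n + j + 4).succ_ne_zero
      push_cast at h ⊢
      rw [show (n : ℂ) + 2 + (j + 1 + 2) = n + j + 5 by ring,
        show (n : ℂ) + 1 + (j + 1 + 2) = n + j + 4 by ring,
        show (n : ℂ) + 2 + (j + 2) = n + j + 4 by ring,
        show (n : ℂ) + 1 + (j + 2) = n + j + 3 by ring]
      rw [show j + 2 + 1 = j + 1 + 2 by ring] at h
      field_simp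
      linear_combination ((j + 1 : ℂ) * (j + 2) * (n + j + 3)) * h)).1
  rw [main, Finset.prod_div_distrib, prod_sub_natCast_add, prod_add_three hx, ratioProd,
    Finset.prod_div_distrib]
  have h2 := weight_two hx (n + 2)
  have hD : ∏ i ∈ range n, (x + ((i : ℂ) + 1)) ≠ 0 :=
    Finset.prod_ne_zero_iff.mpr fun i _ => add_succ_ne_zero_of_not_int hx i
  have b1 : x + n + 1 ≠ 0 := by
    simpa [add_assoc] using add_succ_ne_zero_of_not_int hx n
  have b2 : x + n + 2 ≠ 0 := fun h => hx (-n - 2) (by push_cast; linear_combination h)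
  have a1 : (n + 3 : ℂ) ≠ 0 := by exact_mod_cast (n + 2).succ_ne_zero
  have a2 : (n + 4 : ℂ) ≠ 0 := by exact_mod_cast (n + 3).succ_ne_zero
  push_cast at h2 ⊢
  rw [show (n : ℂ) + 2 + 2 = n + 4 by ring, show (n : ℂ) + 1 + 2 = n + 3 by ring]
  generalize ∏ i ∈ range n, (x + ((i : ℂ) + 1)) = p at *
  generalize ∏ i ∈ range n, (x - ((i : ℂ) + 1)) = q at *
  field_simp
  linear_combination q * h2

theorem sum_fallingWeight_mul_genH (hx : ∀ m : ℤ, x ≠ (m : ℂ)) (m : ℕ) :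
    ∑ k ∈ range (m + 3), fallingWeight x (m + 1) k * genH k x =
      (m + 1) * (m + 2) * (m + 3) * ratioProd (m + 1) x / ((x - 1) * (x + m + 2)) *
        (genH (m + 2) x + genH (m + 1) (-x) - 1 / (1 - x)) := by
  have x1 : x + 1 ≠ 0 := by exact_mod_cast add_natCast_ne_zero_of_not_int hx 1
  have x2 : x + 2 ≠ 0 := by exact_mod_cast add_natCast_ne_zero_of_not_int hx 2
  have x3 : x - 1 ≠ 0 := by exact_mod_cast sub_natCast_ne_zero_of_not_int hx 1
  have hc : ∀ j : ℕ, x + 3 + j ≠ 0 := fun j h =>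
    hx (-3 - j) (by push_cast; linear_combination h)
  have hd : ∀ j : ℕ, x - 1 - m + j ≠ 0 := fun j h =>
    hx (1 + m - j) (by push_cast; linear_combination h)
  rw [sum_range_add_two_of_zero (by simp [fallingWeight]) (by simp [fallingWeight])]
  obtain ⟨main1, main2⟩ := sum_of_term_ratio hc hd m
    (fun j => fallingWeight x (m + 1) (j + 2)) (fun j => by
      have h := weight_succ_index x (add_succ_ne_zero_of_not_int hx) (m + 2) (j + 2)
      have a2 : (m + j + 4 : ℂ) ≠ 0 := by exact_mod_cast (m + j + 3).succ_ne_zero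
      have a3 : (m + j + 5 : ℂ) ≠ 0 := by exact_mod_cast (m + j + 4).succ_ne_zero
      unfold fallingWeight
      push_cast at h ⊢
      rw [show (m : ℂ) + 1 + 1 + (j + 1 + 2) = m + j + 5 by ring,
        show (m : ℂ) + 1 + 1 + (j + 2) = m + j + 4 by ring]
      rw [show j + 2 + 1 = j + 1 + 2 by ring] at h
      rw [show m + 1 + 1 = m + 2 by ring]
      field_simp
      linear_combination ((j + 1 : ℂ) * (j + 2) * (m + j + 4)) * h)
  have split : ∀ j : ℕ, genH (j + 2) x = 1 / (x + 1) + 1 / (x + 2) + genH j (x + 3 - 1) := by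
    intro j
    rw [genH_succ_left, genH_succ_left, show x + 1 + 1 = x + 2 by ring,
      show x + 3 - 1 = x + 2 by ring, add_assoc]
  have hsum : ∑ j ∈ range (m + 1), fallingWeight x (m + 1) (j + 2) * genH (j + 2) x =
      (1 / (x + 1) + 1 / (x + 2)) * ∑ j ∈ range (m + 1), fallingWeight x (m + 1) (j + 2) +
      ∑ j ∈ range (m + 1), fallingWeight x (m + 1) (j + 2) * genH j (x + 3 - 1) := by
    rw [Finset.mul_sum, ← Finset.sum_add_distrib]
    exact Finset.sum_congr rfl fun j _ => by rw [split]; ring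
  have hneg : genH (m + 1) (-x) = 1 / (1 - x) + genH m (-(x - 1)) := by
    rw [genH_succ_left, show -x + 1 = 1 - x by ring, show -(x - 1) = 1 - x by ring]
  have hshift : ∏ i ∈ range m, (x - 1 - ((i : ℂ) + 1)) =
      (∏ i ∈ range (m + 1), (x - ((i : ℂ) + 1))) / (x - 1) := by
    rw [eq_div_iff x3, Finset.prod_range_succ']
    congr 1
    · refine Finset.prod_congr rfl fun i _ => ?_
      push_cast
      ring
    · simp
  rw [hsum, main1, main2, genH_sub_natCast, hneg, split m, Finset.prod_div_distrib,
    prod_sub_natCast_add, prod_add_three hx, ratioProd, Finset.prod_div_distrib, hshift,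
    Finset.prod_range_succ (fun i : ℕ => x + ((i : ℂ) + 1))]
  have h2 := weight_two hx (m + 2)
  have hD : ∏ i ∈ range m, (x + ((i : ℂ) + 1)) ≠ 0 :=
    Finset.prod_ne_zero_iff.mpr fun i _ => add_succ_ne_zero_of_not_int hx i
  have b1 : x + (m + 1) ≠ 0 := add_succ_ne_zero_of_not_int hx m
  have b2 : x + m + 2 ≠ 0 := fun h => hx (-m - 2) (by push_cast; linear_combination h)
  have a2 : (m + 4 : ℂ) ≠ 0 := by exact_mod_cast (m + 3).succ_ne_zero
  have hw : fallingWeight x (m + 1) (0 + 2) =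
      (m + 1) * (m + 2) * (m + 3) / ((x + 1) * (x + 2)) := by
    unfold fallingWeight
    push_cast at h2 ⊢
    rw [show (m : ℂ) + 1 + 1 + 2 = m + 4 by ring, eq_div_iff (mul_ne_zero x1 x2),
      show m + 1 + 1 = m + 2 by ring]
    field_simp
    linear_combination h2
  rw [hw, add_assoc x (m : ℂ) 1]
  generalize ∏ i ∈ range m, (x + ((i : ℂ) + 1)) = p at *
  generalize ∏ i ∈ range (m + 1), (x - ((i : ℂ) + 1)) = q at *
  generalize 1 / (x + 1) + 1 / (x + 2) = u
  field_simp
  ring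

end NonInteger

/-- Interlacing two arithmetic progressions of step two. -/
theorem genH_half_add_genH_half (y : ℂ) (m : ℕ) :
    genH m (y / 2) + genH (m + 1) ((y - 1) / 2) =
      2 * ∑ l ∈ range (2 * m + 1), 1 / (y + 1 + l) := by
  have half : ∀ a b : ℂ, 1 / (a / 2 + b) = 2 * (1 / (a + 2 * b)) := by
    intro a b
    rw [show a / 2 + b = (a + 2 * b) / 2 by ring, one_div_div]
    ring
  induction m with
  | zero =>
    rw [genH_succ, half]
    simp only [genH, Finset.sum_range_zero, Finset.sum_range_one, mul_zero, zero_add,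
      CharP.cast_eq_zero, add_zero]
    ring_nf
  | succ m ih =>
    rw [genH_succ, genH_succ (m + 1), show 2 * (m + 1) + 1 = 2 * m + 1 + 1 + 1 by ring,
      Finset.sum_range_succ, Finset.sum_range_succ, half, half]
    push_cast
    rw [show y + 1 + (2 * (m : ℂ) + 1) = y + 2 * (m + 1) by ring,
      show y + 1 + (2 * (m : ℂ) + 2) = y - 1 + 2 * (m + 1 + 1) by ring]
    linear_combination ih

theorem sum_symmetric_inv (x : ℂ) (n : ℕ) :
    ∑ l ∈ range (2 * n + 1), 1 / (x - n + l) = genH n x - genH n (-x) + 1 / x := by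
  induction n with
  | zero => simp [genH]
  | succ n ih =>
    rw [show 2 * (n + 1) + 1 = 2 * n + 1 + 1 + 1 by ring, Finset.sum_range_succ,
      Finset.sum_range_succ', genH_succ, genH_succ]
    have h : ∑ k ∈ range (2 * n + 1), 1 / (x - ((n + 1 : ℕ) : ℂ) + ((k + 1 : ℕ) : ℂ)) =
        ∑ l ∈ range (2 * n + 1), 1 / (x - n + l) :=
      Finset.sum_congr rfl fun k _ => by push_cast; ring_nf
    rw [h, ih]
    push_cast
    rw [show -x + ((n : ℂ) + 1) = -(x - (n + 1) + 0) by ring, one_div_neg_eq_neg_one_div,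
      show x - ((n : ℂ) + 1) + (2 * n + 2) = x + (n + 1) by ring]
    ring

/-- The alternating sum `∑_{j=-n}^n (-1)^(n-j)/(x+j)`, in terms of generalized harmonic numbers. -/
noncomputable def altHarmonic (n : ℕ) (x : ℂ) : ℂ :=
  genH (n + 1) ((x - n - 2) / 2) - (genH n x - genH n (-x) + 1 / x)

theorem altHarmonic_zero (x : ℂ) : altHarmonic 0 x = 1 / x := by
  have h : 1 / ((x - 2) / 2 + 1) = 2 / x := by
    rw [show (x - 2) / 2 + 1 = x / 2 by ring, one_div_div]
  simp only [altHarmonic, genH_succ_left, CharP.cast_eq_zero, sub_zero, h]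
  simp only [genH, Finset.sum_range_zero]
  ring

theorem altHarmonic_succ (n : ℕ) (x : ℂ) :
    altHarmonic (n + 1) x = -altHarmonic n x + 1 / (x + (n + 1)) + 1 / (x - (n + 1)) := by
  have h1 := genH_half_add_genH_half (x - n - 2) (n + 1)
  have h2 := sum_symmetric_inv x (n + 1)
  have h3 : 1 / (-x + ((n : ℂ) + 1)) = -(1 / (x - (n + 1))) := by
    rw [← one_div_neg_eq_neg_one_div]
    ring_nf
  push_cast at h2
  rw [show x - n - 2 + 1 = x - ((n : ℂ) + 1) by ring, h2,
    show x - n - 2 - 1 = x - ((n : ℂ) + 1) - 2 by ring] at h1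
  unfold altHarmonic
  push_cast
  rw [genH_succ n x, genH_succ n (-x), h3] at h1 ⊢
  linear_combination h1

section NonInteger

variable {x : ℂ}

theorem fallingWeight_eq (x : ℂ) (n k : ℕ) :
    fallingWeight x n k = (n + 2 - k) *
      ((k : ℂ) * (k - 1) * weight x (n + 2) k / ((n + 2 + k) * (n + 1 + k))) := by
  have h := weight_succ_degree x (n + 1) k
  have a1 : (n + 1 + k : ℂ) ≠ 0 := by exact_mod_cast (by omega : n + 1 + k ≠ 0)
  have a2 : (n + 2 + k : ℂ) ≠ 0 := by exact_mod_cast (by omega : n + 2 + k ≠ 0)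
  unfold fallingWeight
  push_cast at h
  field_simp
  linear_combination -(k : ℂ) * (k - 1) * h

theorem sum_fallingWeight_div_succ (hx : ∀ m : ℤ, x ≠ (m : ℂ)) (n : ℕ) :
    (x + n + 2) * ∑ k ∈ range (n + 3), fallingWeight x (n + 1) k / (x + k) +
      (x - (n + 1)) * ∑ k ∈ range (n + 2), fallingWeight x n k / (x + k) =
      (2 * n + 3) * ((n + 1) * (n + 2) * ratioProd n x / ((x + n + 1) * (x + n + 2))) := by
  have hlast : ∑ k ∈ range (n + 2), fallingWeight x n k / (x + k) =
      ∑ k ∈ range (n + 3), fallingWeight x n k / (x + k) := by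
    rw [Finset.sum_range_succ _ (n + 2), fallingWeight_eq_zero (by omega), zero_div, add_zero]
  rw [hlast, ← sum_weight_div hx, Finset.mul_sum, Finset.mul_sum, Finset.mul_sum,
    ← Finset.sum_add_distrib]
  refine Finset.sum_congr rfl fun k _ => ?_
  have hk := add_natCast_ne_zero_of_not_int hx k
  have a1 : (n + 1 + k : ℂ) ≠ 0 := by exact_mod_cast (by omega : n + 1 + k ≠ 0)
  have a2 : (n + 2 + k : ℂ) ≠ 0 := by exact_mod_cast (by omega : n + 2 + k ≠ 0)
  rw [fallingWeight_eq x n k]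
  unfold fallingWeight
  push_cast
  rw [show (n : ℂ) + 1 + 1 + k = n + 2 + k by ring, show n + 1 + 1 = n + 2 by ring]
  field_simp
  ring

theorem sum_fallingWeight_div (hx : ∀ m : ℤ, x ≠ (m : ℂ)) (n : ℕ) :
    ∑ k ∈ range (n + 2), fallingWeight x n k / (x + k) =
      ratioProd n x / (x + n + 1) *
        (x * (x + 1) * (altHarmonic n x - 1 / (x + n + 1)) - (n + 1)) := by
  induction n with
  | zero =>
    have x0 : x ≠ 0 := by exact_mod_cast hx 0
    have x1 : x + 1 ≠ 0 := by exact_mod_cast add_natCast_ne_zero_of_not_int hx 1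
    rw [altHarmonic_zero]
    simp only [Finset.sum_range_succ, fallingWeight, ratioProd]
    simp
    right
    field_simp
    ring
  | succ n ih =>
    have h := sum_fallingWeight_div_succ hx n
    have b1 : x + n + 1 ≠ 0 := by
      simpa [add_assoc] using add_succ_ne_zero_of_not_int hx n
    have b2 : x + n + 2 ≠ 0 := fun h => hx (-n - 2) (by push_cast; linear_combination h)
    have b3 : x - (n + 1) ≠ 0 := fun h => hx (n + 1) (by push_cast; linear_combination h)
    rw [ih] at h
    apply mul_left_cancel₀ b2
    rw [eq_sub_of_add_eq h, altHarmonic_succ, ratioProd_succ]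
    push_cast
    rw [show x + ((n : ℂ) + 1) + 1 = x + n + 2 by ring, ← add_assoc x]
    field_simp
    ring

/-- Summation by parts: the first order recurrence of the sum in its degree. -/
theorem sum_weight_mul_sq_succ (hx : ∀ m : ℤ, x ≠ (m : ℂ)) (n : ℕ) :
    n * (x + (n + 1)) * ∑ k ∈ range (n + 2), weight x (n + 1) k * k * genH k x ^ 2 -
      (n + 2) * (x - (n + 1)) * ∑ k ∈ range (n + 1), weight x n k * k * genH k x ^ 2 =
      2 * (n + 1) * (2 * ∑ k ∈ range (n + 2), fallingWeight x n k * genH k x -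
        ∑ k ∈ range (n + 2), fallingWeight x n k / (x + k)) := by
  set φ : ℕ → ℂ := fun k => 2 * (n + 1) *
    (2 * (fallingWeight x n k * genH k x) - fallingWeight x n k / (x + k))
  set g : ℕ → ℂ := fun k => -(2 * (n + 1) * (x + k) * fallingWeight x n k) * genH k x ^ 2
  have hlast : ∑ k ∈ range (n + 1), weight x n k * k * genH k x ^ 2 =
      ∑ k ∈ range (n + 2), weight x n k * k * genH k x ^ 2 := by
    rw [Finset.sum_range_succ _ (n + 1), weight_eq_zero (by omega)]
    ring
  have hφ : 2 * (n + 1) * (2 * ∑ k ∈ range (n + 2), fallingWeight x n k * genH k x -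
      ∑ k ∈ range (n + 2), fallingWeight x n k / (x + k)) = ∑ k ∈ range (n + 2), φ (k + 1) := by
    have e : ∑ k ∈ range (n + 2), φ (k + 1) = ∑ k ∈ range (n + 2), φ k := by
      have h1 := Finset.sum_range_succ φ (n + 2)
      have h2 := Finset.sum_range_succ' φ (n + 2)
      have h3 : φ (n + 2) = 0 := by simp [φ, fallingWeight_eq_zero (show n + 1 < n + 2 by omega)]
      have h4 : φ 0 = 0 := by simp [φ, fallingWeight]
      linear_combination h1 - h2 + h3 - h4
    rw [e, Finset.mul_sum, ← Finset.sum_sub_distrib, Finset.mul_sum]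
  have hg : ∑ k ∈ range (n + 2), (g (k + 1) - g k) = 0 := by
    rw [Finset.sum_range_sub]
    have h0 : fallingWeight x n 0 = 0 := by simp [fallingWeight]
    simp [g, fallingWeight_eq_zero (show n + 1 < n + 2 by omega), h0]
  rw [hlast, hφ, ← add_zero (∑ k ∈ range (n + 2), φ (k + 1)), ← hg, ← Finset.sum_add_distrib,
    Finset.mul_sum, Finset.mul_sum, ← Finset.sum_sub_distrib]
  refine Finset.sum_congr rfl fun k _ => ?_
  have hk := add_succ_ne_zero_of_not_int hx k
  have a1 : (n + 1 + k : ℂ) ≠ 0 := by exact_mod_cast (by omega : n + 1 + k ≠ 0)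
  have a2 : (n + 1 + (k + 1) : ℂ) ≠ 0 := by exact_mod_cast (by omega : n + 1 + (k + 1) ≠ 0)
  have h1 : weight x n k = (n + 1 - k) * weight x (n + 1) k / (n + 1 + k) := by
    rw [eq_div_iff a1]
    linear_combination -weight_succ_degree x n k
  have h2 : (x + (k + 1)) * fallingWeight x n (k + 1) =
      -(k * (n + 1 - k) * weight x (n + 1) k) := by
    have := weight_succ_index x (add_succ_ne_zero_of_not_int hx) (n + 1) k
    unfold fallingWeight
    push_cast at this ⊢
    field_simp
    linear_combination (k : ℂ) * this
  have h3 : fallingWeight x n (k + 1) =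
      -(k * (n + 1 - k) * weight x (n + 1) k) / (x + (k + 1)) := by
    rw [eq_div_iff hk, ← h2]
    ring
  simp only [φ, g]
  rw [h1, h3, genH_succ]
  unfold fallingWeight
  push_cast
  field_simp
  ring

/-- The closed form in terms of the alternating harmonic sum. -/
theorem sum_weight_mul_sq (hx : ∀ m : ℤ, x ≠ (m : ℂ)) (m : ℕ) :
    ∑ k ∈ range (m + 2), weight x (m + 1) k * k * genH k x ^ 2 =
      (m + 1) * (m + 2) / (2 * (1 - x)) * ratioProd (m + 1) x *
        (genH2 (m + 1) x - genH2 (m + 1) (-x)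
          + 2 * (genH (m + 1) x + genH (m + 1) (-x) - 1 / (1 - x)) ^ 2 + 2 / (1 - x) ^ 2
          - (altHarmonic (m + 1) x + x / ((m + 1) * (m + 2))) ^ 2
          + x ^ 2 / ((m + 1) * (m + 2)) ^ 2 + 1 / x ^ 2 + 2 / ((m + 1) * (m + 2))) := by
  have x0 : x ≠ 0 := by exact_mod_cast hx 0
  have x1 : x + 1 ≠ 0 := by exact_mod_cast add_natCast_ne_zero_of_not_int hx 1
  have x2 : 1 - x ≠ 0 := fun h => hx 1 (by push_cast; linear_combination -h)
  induction m with
  | zero =>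
    have h1 : weight x 1 1 = -2 / (x + 1) := by
      have := weight_succ_index x (add_succ_ne_zero_of_not_int hx) 1 0
      have hw : weight x 1 0 = 1 := by simp [weight, cbinom]
      rw [hw] at this
      norm_num at this
      rw [eq_div_iff x1]
      linear_combination this
    have x3 : x - 1 ≠ 0 := fun h => x2 (by linear_combination -h)
    have x4 : -x + 1 ≠ 0 := fun h => x2 (by linear_combination h)
    rw [altHarmonic_succ, altHarmonic_zero]
    simp only [Finset.sum_range_succ, Finset.sum_range_zero, ratioProd, genH, genH2,
      Finset.prod_range_succ, Finset.prod_range_zero, h1, CharP.cast_eq_zero, Nat.cast_one]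
    norm_num
    rw [show -x + 1 = 1 - x by ring, show x - 1 = -(1 - x) by ring]
    field_simp
    ring
  | succ m ih =>
    have h := sum_weight_mul_sq_succ hx (m + 1)
    have b1 : x + (m + 1) + 1 ≠ 0 := fun h => hx (-m - 2) (by push_cast; linear_combination h)
    have b3 : x - (m + 2) ≠ 0 := fun h => hx (m + 2) (by push_cast; linear_combination h)
    have a1 : (m + 1 : ℂ) ≠ 0 := by exact_mod_cast m.succ_ne_zero
    have a2 : (m + 2 : ℂ) ≠ 0 := by exact_mod_cast (m + 1).succ_ne_zero
    have a3 : (m + 3 : ℂ) ≠ 0 := by exact_mod_cast (m + 2).succ_ne_zero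
    have x3 : x - 1 = -(1 - x) := by ring
    have b2 : x + (m + 2) ≠ 0 := fun h => b1 (by linear_combination h)
    rw [show m + 1 + 2 = m + 3 by ring, show m + 1 + 1 = m + 2 by ring, ih,
      sum_fallingWeight_mul_genH hx, sum_fallingWeight_div hx] at h
    rw [show m + 1 + 2 = m + 3 by ring, show m + 1 + 1 = m + 2 by ring,
      altHarmonic_succ (m + 1), ratioProd_succ (m + 1), genH2_succ (m + 1), genH2_succ (m + 1)]
    rw [genH_succ (m + 1) x] at *
    rw [genH_succ (m + 1) (-x)]
    push_cast at h ⊢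
    rw [show -x + ((m : ℂ) + 1 + 1) = -(x - (m + 2)) by ring]
    simp only [show (m : ℂ) + 1 + 2 = m + 3 by ring, show (m : ℂ) + 1 + 1 = m + 2 by ring,
      show x + ((m : ℂ) + 1) + 1 = x + (m + 2) by ring,
      show x + (m : ℂ) + 2 = x + (m + 2) by ring, x3] at h ⊢
    apply mul_left_cancel₀ (mul_ne_zero a1 b2)
    rw [eq_add_of_sub_eq h]
    generalize genH (m + 1) x = a
    generalize genH (m + 1) (-x) = b
    generalize genH2 (m + 1) x = c
    generalize genH2 (m + 1) (-x) = d
    generalize altHarmonic (m + 1) x = e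
    generalize ratioProd (m + 1) x = p
    field_simp
    ring

end NonInteger

theorem stmt4 (n : ℕ) (hn : 0 < n) (x : ℂ) (hx : ∀ m : ℤ, x ≠ (m : ℂ)) :
    ∑ k ∈ Finset.range (n + 1),
      (-1 : ℂ) ^ k * (n.choose k : ℂ) * (((n + k).choose k : ℂ) / cbinom (x + k) k) *
        (k : ℂ) * (genH k x) ^ 2
    = (-1 : ℂ) ^ n * ((n : ℂ) * (n + 1) / (2 * (1 - x))) *
      (cbinom (-x + n) n / cbinom (x + n) n) *
      (genH2 n x - genH2 n (-x)
        + 2 * (genH n x + genH n (-x)) * (genH n x + genH n (-x) - 2 / (1 - x))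
        - (genH n x - genH n (-x)) *
          (genH n x - genH n (-x) - 2 * genH (n + 1) ((x - n - 2) / 2)
            - 2 * (x ^ 2 - n - (n : ℂ) ^ 2) / (x * n * (n + 1)))
        - genH n ((x - n) / 2) *
          (genH (n + 1) ((x - n - 2) / 2)
            + 2 * (x ^ 3 - n * x ^ 2 + (n : ℂ) ^ 2 + (n : ℂ) ^ 3) / (x * (x - n) * n * (n + 1)))
        + 4 / (1 - x) ^ 2
        - 4 * (x ^ 2 - n * x + n + (n : ℂ) ^ 2) / (x * (x - n) ^ 2 * (n + 1))) := by
  obtain ⟨m, rfl⟩ : ∃ m, n = m + 1 := ⟨n - 1, by omega⟩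
  have x0 : x ≠ 0 := by exact_mod_cast hx 0
  have x2 : 1 - x ≠ 0 := fun h => hx 1 (by push_cast; linear_combination -h)
  have x3 : x - (m + 1) ≠ 0 := fun h => hx (m + 1) (by push_cast; linear_combination h)
  have a1 : (m + 1 : ℂ) ≠ 0 := by exact_mod_cast m.succ_ne_zero
  have a2 : (m + 2 : ℂ) ≠ 0 := by exact_mod_cast (m + 1).succ_ne_zero
  have main := sum_weight_mul_sq hx m
  have hH : genH (m + 1 + 1) ((x - ((m + 1 : ℕ) : ℂ) - 2) / 2) =
      2 / (x - (m + 1)) + genH (m + 1) ((x - ((m + 1 : ℕ) : ℂ)) / 2) := by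
    rw [genH_succ_left, show (x - ((m + 1 : ℕ) : ℂ) - 2) / 2 + 1 = (x - ((m + 1 : ℕ) : ℂ)) / 2 by ring,
      one_div_div]
    push_cast
    rfl
  unfold altHarmonic at main
  rw [ratioProd_eq_cbinom, hH] at main
  rw [hH]
  unfold weight at main
  rw [main]
  push_cast
  simp only [show (m : ℂ) + 1 + 1 = m + 2 by ring]
  generalize genH (m + 1) x = a
  generalize genH (m + 1) (-x) = b
  generalize genH2 (m + 1) x = c
  generalize genH2 (m + 1) (-x) = d
  generalize genH (m + 1) ((x - ((m : ℂ) + 1)) / 2) = e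
  generalize cbinom (-x + ((m : ℂ) + 1)) (m + 1) / cbinom (x + ((m : ℂ) + 1)) (m + 1) = p
  rw [mul_left_comm, ← mul_assoc ((-1 : ℂ) ^ (m + 1))]
  field_simp
  ring
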